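/- Let λ_1 < λ_2 < … be a strictly increasing sequence of real numbers with average gap 1 and Poisson pair correlations. Then limsup_{n→∞} (λ_{n+1} − λ_n) > 3/2 + 10^{-9}. -/

import Mathlib

open Finset Filter

namespace PPCaux

/-- Asymptotic upper bound for averages. -/
def UB (φ : ℕ → ℝ) (c : ℝ) : Prop :=
  ∀ δ > 0, ∃ C : ℝ, ∀ N : ℕ, ∑ n ∈ Finset.Icc 1 N, φ n ≤ (c + δ) * N + C

lemma bound_of_tendsto {f : ℕ → ℝ} {c : ℝ}
    (h : Tendsto (fun N : ℕ => f N / N) atTop (nhds c)) :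
    ∀ δ > 0, ∃ C : ℝ, ∀ N : ℕ, f N ≤ (c + δ) * N + C := by
  intro δ hδ
  have h1 : ∀ᶠ N : ℕ in atTop, f N / N < c + δ := h.eventually_lt_const (by linarith)
  obtain ⟨N0, hN0⟩ := eventually_atTop.1 h1
  refine ⟨∑ N ∈ Finset.range (N0 + 1), |f N - (c + δ) * N|, fun N => ?_⟩
  by_cases hN : N < N0 + 1
  · have := Finset.single_le_sum (f := fun N : ℕ => |f N - (c + δ) * N|)
      (fun i _ => abs_nonneg _) (Finset.mem_range.2 hN)
    have h2 := le_abs_self (f N - (c + δ) * N)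
    linarith
  · have h3 := hN0 N (by omega)
    have hpos : (0 : ℝ) < N := by
      have : 0 < N := by omega
      exact_mod_cast this
    rw [div_lt_iff₀ hpos] at h3
    have : 0 ≤ ∑ N ∈ Finset.range (N0 + 1), |f N - (c + δ) * N| :=
      Finset.sum_nonneg (fun i _ => abs_nonneg _)
    linarith

lemma UB.add {φ ψ : ℕ → ℝ} {c d : ℝ} (h1 : UB φ c) (h2 : UB ψ d) :
    UB (fun n => φ n + ψ n) (c + d) := by
  intro δ hδ
  obtain ⟨C, hC⟩ := h1 (δ / 2) (by linarith)
  obtain ⟨D, hD⟩ := h2 (δ / 2) (by linarith)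
  refine ⟨C + D, fun N => ?_⟩
  rw [Finset.sum_add_distrib]
  have := hC N
  have := hD N
  linarith

lemma UB.zero : UB (fun _ => 0) 0 := by
  intro δ hδ
  refine ⟨0, fun N => ?_⟩
  simp only [Finset.sum_const_zero]
  positivity

lemma UB.const (a : ℝ) : UB (fun _ => a) a := by
  intro δ hδ
  refine ⟨0, fun N => ?_⟩
  simp only [Finset.sum_const, Nat.card_Icc, nsmul_eq_mul]
  have : (0 : ℝ) ≤ δ * N := by positivity
  simp only [Nat.add_sub_cancel]
  linarith

lemma UB.smul {φ : ℕ → ℝ} {c a : ℝ} (ha : 0 ≤ a) (h : UB φ c) :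
    UB (fun n => a * φ n) (a * c) := by
  intro δ hδ
  rcases ha.eq_or_lt with h0 | h0
  · subst h0
    refine ⟨0, fun N => ?_⟩
    simp only [zero_mul, Finset.sum_const_zero]
    positivity
  · obtain ⟨C, hC⟩ := h (δ / a) (by positivity)
    refine ⟨a * C, fun N => ?_⟩
    rw [← Finset.mul_sum]
    have := mul_le_mul_of_nonneg_left (hC N) ha
    have e : a * ((c + δ / a) * N + C) = (a * c + δ) * N + a * C := by
      field_simp
    linarith

lemma UB.sum {ι : Type} (s : Finset ι) {φ : ι → ℕ → ℝ} {c : ι → ℝ}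
    (h : ∀ i ∈ s, UB (φ i) (c i)) :
    UB (fun n => ∑ i ∈ s, φ i n) (∑ i ∈ s, c i) := by
  classical
  induction s using Finset.induction_on with
  | empty => simpa using UB.zero
  | insert a s ha ih =>
    simp only [Finset.sum_insert ha]
    exact (h a (by simp)).add (ih (fun i hi => h i (by simp [hi])))

lemma UB.mono {φ ψ : ℕ → ℝ} {c : ℝ} (h : UB ψ c) (hle : ∀ᶠ n in atTop, φ n ≤ ψ n) :
    UB φ c := by
  obtain ⟨n0, hn0⟩ := eventually_atTop.1 hle
  intro δ hδ
  obtain ⟨C, hC⟩ := h δ hδ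
  refine ⟨C + ∑ n ∈ Finset.range n0, |φ n - ψ n|, fun N => ?_⟩
  have h1 : ∑ n ∈ Finset.Icc 1 N, (φ n - ψ n) ≤ ∑ n ∈ Finset.range n0, |φ n - ψ n| := by
    calc ∑ n ∈ Finset.Icc 1 N, (φ n - ψ n)
        ≤ ∑ n ∈ Finset.Icc 1 N, (if n < n0 then |φ n - ψ n| else 0) := by
          apply Finset.sum_le_sum
          intro n _
          split_ifs with hh
          · exact le_abs_self _
          · have := hn0 n (by omega)
            linarith
      _ = ∑ n ∈ (Finset.Icc 1 N).filter (fun n => n < n0), |φ n - ψ n| := by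
          rw [Finset.sum_filter]
      _ ≤ _ := by
          apply Finset.sum_le_sum_of_subset_of_nonneg
          · intro n hn
            simp only [Finset.mem_filter] at hn
            exact Finset.mem_range.2 hn.2
          · intros; exact abs_nonneg _
  rw [Finset.sum_sub_distrib] at h1
  have := hC N
  linarith

lemma UB.mono' {φ ψ : ℕ → ℝ} {c : ℝ} (h : UB ψ c) (hle : ∀ n, φ n ≤ ψ n) : UB φ c :=
  h.mono (Eventually.of_forall hle)

lemma UB.closed {φ : ℕ → ℝ} {c : ℝ} (h : ∀ δ > 0, UB φ (c + δ)) : UB φ c := by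
  intro δ hδ
  obtain ⟨C, hC⟩ := h (δ / 2) (by linarith) (δ / 2) (by linarith)
  refine ⟨C, fun N => ?_⟩
  have := hC N
  have e : c + δ / 2 + δ / 2 = c + δ := by ring
  rwa [e] at this

lemma UB.le {φ : ℕ → ℝ} {c d : ℝ} (h : UB φ c) (hd : c ≤ d) : UB φ d := by
  intro δ hδ
  obtain ⟨C, hC⟩ := h δ hδ
  refine ⟨C, fun N => ?_⟩
  have := hC N
  have : (c + δ) * N ≤ (d + δ) * N := by gcongr
  linarith

lemma UB.ge {φ : ℕ → ℝ} {c d : ℝ} (h : UB φ c) (hd : ∀ n, d ≤ φ n) : d ≤ c := by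
  by_contra hlt
  push Not at hlt
  obtain ⟨C, hC⟩ := h ((d - c) / 2) (by linarith)
  obtain ⟨N, hN⟩ := exists_nat_gt (C / ((d - c) / 2))
  rw [div_lt_iff₀ (by linarith)] at hN
  have h1 := hC N
  have h2 : ∑ n ∈ Finset.Icc 1 N, d ≤ ∑ n ∈ Finset.Icc 1 N, φ n :=
    Finset.sum_le_sum (fun n _ => hd n)
  simp only [Finset.sum_const, Nat.card_Icc, nsmul_eq_mul, Nat.add_sub_cancel] at h2
  nlinarith

lemma UB.diff1 {φ : ℕ → ℝ} {B : ℝ} (hB : ∀ n, |φ n| ≤ B) :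
    UB (fun n => φ (n + 1) - φ n) 0 := by
  intro δ hδ
  refine ⟨2 * B, fun N => ?_⟩
  have e : ∑ n ∈ Finset.Icc 1 N, (φ (n + 1) - φ n) = φ (N + 1) - φ 1 := by
    induction N with
    | zero => simp
    | succ k ih => rw [Finset.sum_Icc_succ_top (by omega), ih]; ring
  rw [e]
  have h1 := abs_le.1 (hB (N + 1))
  have h2 := abs_le.1 (hB 1)
  have : 0 ≤ (0 + δ) * N := by positivity
  linarith

lemma UB.diff {φ : ℕ → ℝ} {B : ℝ} (hB : ∀ n, |φ n| ≤ B) (j : ℕ) :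
    UB (fun n => φ (n + j) - φ n) 0 := by
  induction j with
  | zero => simpa using UB.zero
  | succ j ih =>
    have := (UB.diff1 (φ := fun n => φ (n + j)) (fun n => hB _)).add ih
    simp only [add_zero] at this
    refine this.mono' (fun n => ?_)
    have : n + 1 + j = n + (j + 1) := by ring
    rw [this]; linarith

lemma UB.shift1 {φ : ℕ → ℝ} {c : ℝ} (h : UB φ c) : UB (fun n => φ (n + 1)) c := by
  intro δ hδ
  obtain ⟨C, hC⟩ := h δ hδ
  refine ⟨C + (c + δ) - φ 1, fun N => ?_⟩
  have e : ∑ n ∈ Finset.Icc 1 N, φ (n + 1) = ∑ n ∈ Finset.Icc 1 (N + 1), φ n - φ 1 := by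
    induction N with
    | zero => simp
    | succ k ih => 
      rw [Finset.sum_Icc_succ_top (by omega), ih, Finset.sum_Icc_succ_top (b := k + 1) (by omega)]
      ring
  rw [e]
  have := hC (N + 1)
  push_cast at this
  linarith

lemma UB.shift {φ : ℕ → ℝ} {c : ℝ} (h : UB φ c) (j : ℕ) : UB (fun n => φ (n + j)) c := by
  induction j with
  | zero => simpa using h
  | succ j ih =>
    refine ih.shift1.mono' (fun n => ?_)
    have : n + 1 + j = n + (j + 1) := by ring
    rw [this]

open scoped Classical in
/-- Indicator of `[a,b)`. -/
noncomputable def ind (a b s : ℝ) : ℝ := if a ≤ s ∧ s < b then 1 else 0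

open scoped Classical in
lemma ppc_ind (lam : ℕ → ℝ)
    (hppc : ∀ I : Set ℝ, I.OrdConnected → Bornology.IsBounded I →
      Tendsto (fun N : ℕ =>
          (((Finset.Icc 1 N ×ˢ Finset.Icc 1 N).filter
            (fun p => p.1 ≠ p.2 ∧ lam p.2 - lam p.1 ∈ I)).card : ℝ) / N)
        atTop (nhds (MeasureTheory.volume I).toReal)) (m : ℕ) (a b : ℝ) (hab : a ≤ b) :
    UB (fun n => ∑ k ∈ Finset.Icc 1 m, ind a b (lam (n + k) - lam n)) (b - a) := by
  have h := bound_of_tendsto (hppc (Set.Ico a b) Set.ordConnected_Ico (Metric.isBounded_Ico a b))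
  rw [Real.volume_Ico, ENNReal.toReal_ofReal (by linarith)] at h
  intro δ hδ
  obtain ⟨C, hC⟩ := h δ hδ
  refine ⟨C + (b - a + δ) * m, fun N => ?_⟩
  have h1 := hC (N + m)
  have h2 : ∑ n ∈ Finset.Icc 1 N, ∑ k ∈ Finset.Icc 1 m, ind a b (lam (n + k) - lam n)
      ≤ (((Finset.Icc 1 (N + m) ×ˢ Finset.Icc 1 (N + m)).filter
            (fun p => p.1 ≠ p.2 ∧ lam p.2 - lam p.1 ∈ Set.Ico a b)).card : ℝ) := by
    rw [← Finset.sum_product']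
    unfold ind
    rw [← Finset.sum_filter, Finset.sum_const, nsmul_eq_mul, mul_one]
    norm_cast
    apply Finset.card_le_card_of_injOn (fun p => (p.1, p.1 + p.2))
    · intro p hp
      simp only [Finset.coe_filter, Finset.mem_product, Finset.mem_Icc, Set.mem_ofPred_eq,
        Set.mem_Ico] at hp ⊢
      refine ⟨⟨⟨by omega, by omega⟩, by omega, by omega⟩, by omega, hp.2⟩
    · intro p _ q _ hpq
      simp only [Prod.mk.injEq] at hpq
      ext
      · exact hpq.1
      · omega
  push_cast at h1
  have e : (b - a + δ) * ((N : ℝ) + m) + C = (b - a + δ) * N + (C + (b - a + δ) * m) := by ring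
  rw [e] at h1
  refine h2.trans (le_trans (le_of_eq ?_) h1)
  congr!

lemma ind_nonneg (a b s : ℝ) : 0 ≤ ind a b s := by
  unfold ind; split_ifs <;> norm_num

lemma ppc_fun {lam : ℕ → ℝ} {m : ℕ}
    (hi : ∀ a b : ℝ, a ≤ b →
      UB (fun n => ∑ k ∈ Finset.Icc 1 m, ind a b (lam (n + k) - lam n)) (b - a))
    {F Φ : ℝ → ℝ} {L a b : ℝ} (hab : a < b)
    (hΦ : ∀ x, HasDerivAt Φ (F x) x) (hL : ∀ x y, |F x - F y| ≤ L * |x - y|)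
    (hF : ∀ x, a ≤ x → x ≤ b → 0 ≤ F x) :
    UB (fun n => ∑ k ∈ Finset.Icc 1 m,
      ind a b (lam (n + k) - lam n) * F (lam (n + k) - lam n)) (Φ b - Φ a) := by
  have hL0 : 0 ≤ L := by
    have := (abs_nonneg _).trans (hL 0 1)
    simpa using this
  apply UB.closed
  intro δ hδ
  obtain ⟨q, hq⟩ := exists_nat_gt (L * (b - a) ^ 2 / δ)
  have hqpos : (0 : ℝ) < q := lt_of_le_of_lt (by positivity) hq
  set h : ℝ := (b - a) / q with hh
  have hhpos : 0 < h := div_pos (by linarith) hqpos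
  have hqh : q * h = b - a := by rw [hh]; field_simp
  let x : ℕ → ℝ := fun i => a + i * h
  let c : ℕ → ℝ := fun i => (Φ (x (i + 1)) - Φ (x i)) / h + L * h
  have hx1 : ∀ i, x (i + 1) - x i = h := by intro i; simp only [x]; push_cast; ring
  have hcell : ∀ i, ∀ t, x i ≤ t → t ≤ x (i + 1) → F t ≤ c i := by
    intro i t h1 h2
    obtain ⟨y, hy, hy2⟩ := exists_hasDerivAt_eq_slope Φ F (a := x i) (b := x (i + 1))
      (by linarith [hx1 i]) (fun z _ => (hΦ z).continuousAt.continuousWithinAt)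
      (fun z _ => hΦ z)
    rw [hx1] at hy2
    simp only [c]
    rw [← hy2]
    have h3 := (le_abs_self _).trans (hL t y)
    have h4 : |t - y| ≤ h := by
      rw [abs_le]; have := hx1 i; constructor <;> linarith [hy.1, hy.2]
    have := mul_le_mul_of_nonneg_left h4 hL0
    linarith
  have hc0 : ∀ i ∈ Finset.range q, 0 ≤ c i := by
    intro i hi'
    have hiq : ((i : ℕ) : ℝ) + 1 ≤ q := by exact_mod_cast Finset.mem_range.1 hi'
    refine le_trans (hF (x i) ?_ ?_) (hcell i (x i) le_rfl (by linarith [hx1 i]))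
    · simp only [x]; have : 0 ≤ (i : ℝ) * h := by positivity
      linarith
    · simp only [x]
      nlinarith
  have hUB := UB.sum (Finset.range q) (fun i hi' => (hi (x i) (x (i + 1))
    (by linarith [hx1 i])).smul (hc0 i hi'))
  have hpt : ∀ s : ℝ, ind a b s * F s ≤ ∑ i ∈ Finset.range q, c i * ind (x i) (x (i + 1)) s := by
    intro s
    by_cases hs : a ≤ s ∧ s < b
    · have e : ind a b s = 1 := by unfold ind; rw [if_pos hs]
      rw [e, one_mul]
      set i := ⌊(s - a) / h⌋₊ with hidef
      have hnn : 0 ≤ (s - a) / h := div_nonneg (by linarith) hhpos.le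
      have hi1 : (i : ℝ) ≤ (s - a) / h := Nat.floor_le hnn
      have hi2 : (s - a) / h < i + 1 := Nat.lt_floor_add_one _
      rw [le_div_iff₀ hhpos] at hi1
      rw [div_lt_iff₀ hhpos] at hi2
      have hiq : i < q := by
        have : (i : ℝ) * h < q * h := by linarith
        exact_mod_cast lt_of_mul_lt_mul_right this hhpos.le
      have hxs : x i ≤ s ∧ s < x (i + 1) := by
        simp only [x]; push_cast; constructor <;> linarith
      have e2 : ind (x i) (x (i + 1)) s = 1 := by unfold ind; rw [if_pos hxs]
      have h5 := Finset.single_le_sum (f := fun i => c i * ind (x i) (x (i + 1)) s)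
        (fun j hj => mul_nonneg (hc0 j hj) (ind_nonneg _ _ _)) (Finset.mem_range.2 hiq)
      simp only [e2, mul_one] at h5
      exact (hcell i s hxs.1 hxs.2.le).trans h5
    · have e : ind a b s = 0 := by unfold ind; rw [if_neg hs]
      rw [e, zero_mul]
      exact Finset.sum_nonneg (fun j hj => mul_nonneg (hc0 j hj) (ind_nonneg _ _ _))
  refine (hUB.mono' (fun n => ?_)).le ?_
  · calc _ ≤ ∑ k ∈ Finset.Icc 1 m, ∑ i ∈ Finset.range q,
          c i * ind (x i) (x (i + 1)) (lam (n + k) - lam n) :=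
          Finset.sum_le_sum (fun k _ => hpt _)
      _ = _ := by
        rw [Finset.sum_comm]
        simp only [Finset.mul_sum]
  · have e1 : ∀ i, c i * (x (i + 1) - x i) = (Φ (x (i + 1)) - Φ (x i)) + L * h ^ 2 := by
      intro i; rw [hx1]; simp only [c]; field_simp
    simp only [e1]
    rw [Finset.sum_add_distrib, Finset.sum_range_sub (fun i => Φ (x i))]
    simp only [Finset.sum_const, Finset.card_range, nsmul_eq_mul]
    have ex : x q = b := by simp only [x]; linarith
    have ex0 : x 0 = a := by simp [x]
    rw [ex, ex0]
    have : (q : ℝ) * (L * h ^ 2) ≤ δ := by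
      rw [div_lt_iff₀ hδ] at hq
      have : (q : ℝ) * (L * h ^ 2) = L * (b - a) ^ 2 / q := by rw [hh]; field_simp
      rw [this, div_le_iff₀ hqpos]
      linarith
    linarith

lemma sin_T (m : ℕ) : Real.sin (3 * Real.pi * (m + 1 / 2)) = -(-1) ^ m := by
  have e : 3 * Real.pi * (m + 1 / 2) = Real.pi / 2 + ((3 * m + 1 : ℕ) : ℝ) * Real.pi := by
    push_cast; ring
  rw [e, Real.sin_add_nat_mul_pi, Real.sin_pi_div_two, pow_succ, pow_mul]
  norm_num

lemma cos_T (m : ℕ) : Real.cos (3 * Real.pi * (m + 1 / 2)) = 0 := by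
  have e : 3 * Real.pi * (m + 1 / 2) = Real.pi / 2 + ((3 * m + 1 : ℕ) : ℝ) * Real.pi := by
    push_cast; ring
  rw [e, Real.cos_add_nat_mul_pi, Real.cos_pi_div_two, mul_zero]

lemma stepF {lam : ℕ → ℝ} {m : ℕ} (hm : 1 ≤ m)
    (hmono : ∀ n, 1 ≤ n → lam n < lam (n + 1))
    (hi : ∀ a b : ℝ, a ≤ b →
      UB (fun n => ∑ k ∈ Finset.Icc 1 m, ind a b (lam (n + k) - lam n)) (b - a))
    (hS : ∀ k : ℕ, UB (fun n => lam (n + k) - lam n) k)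
    {χ : ℕ → ℝ} {p : ℝ} (hχ : UB χ p) (hχ0 : ∀ n, 0 ≤ χ n)
    (hχ1 : ∀ n, lam (n + 1) - lam n < 1 / 2 → χ n = 1) :
    UB (fun n => ∑ k ∈ Finset.Icc 1 m, (-1) ^ m * Real.cos (3 * Real.pi * (lam (n + k) - lam n)))
      (((-1) ^ m - 1) / (3 * Real.pi) + m * (1 + 3 * Real.pi * (m + 1 / 2)) * p) := by
  have hpi := Real.pi_pos
  set σ : ℝ := (-1) ^ m with hσ
  have hσabs : |σ| = 1 := by rw [hσ]; simp
  have hσsq : σ * σ = 1 := by rw [← abs_mul_abs_self, hσabs]; norm_num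
  set T : ℝ := m + 1 / 2 with hT
  have hm1 : (1 : ℝ) ≤ m := by exact_mod_cast hm
  have hlip : ∀ x y, |σ * Real.cos (3 * Real.pi * x) - σ * Real.cos (3 * Real.pi * y)|
      ≤ 3 * Real.pi * |x - y| := by
    intro x y
    rw [← mul_sub, abs_mul, hσabs, one_mul]
    refine (Real.abs_cos_sub_cos_le _ _).trans (le_of_eq ?_)
    rw [← mul_sub, abs_mul, abs_of_pos (by positivity)]
  have hT0 : ∀ x, |σ * Real.cos (3 * Real.pi * x)| ≤ 3 * Real.pi * |x - T| := by
    intro x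
    have := hlip x T
    rwa [hT, cos_T, mul_zero, sub_zero] at this
  have hle1 : ∀ x, σ * Real.cos (3 * Real.pi * x) ≤ 1 := by
    intro x
    refine (le_abs_self _).trans ?_
    rw [abs_mul, hσabs, one_mul]; exact Real.abs_cos_le_one _
  have hUB := ppc_fun hi (F := fun x => σ * Real.cos (3 * Real.pi * x) + 3 * Real.pi * (T - x))
    (Φ := fun x => σ * (Real.sin (3 * Real.pi * x) / (3 * Real.pi))
      + 3 * Real.pi * (T * x - x ^ 2 / 2))
    (L := 6 * Real.pi) (a := 1 / 2) (b := T) (by rw [hT]; linarith)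
    (by
      intro x
      have h1 : HasDerivAt (fun x : ℝ => 3 * Real.pi * x) (3 * Real.pi) x := by
        simpa using (hasDerivAt_id x).const_mul (3 * Real.pi)
      have h2 := ((h1.sin).div_const (3 * Real.pi)).const_mul σ
      have h3 : HasDerivAt (fun x : ℝ => T * x - x ^ 2 / 2) (T - x) x := by
        have := ((hasDerivAt_id x).const_mul T).sub (((hasDerivAt_id x).pow 2).div_const 2)
        have e : T * 1 - ((2 : ℕ) : ℝ) * id x ^ (2 - 1) * 1 / 2 = T - x := by simp
        rw [e] at this
        exact this
      have h4 := h2.add (h3.const_mul (3 * Real.pi))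
      have e : σ * (Real.cos (3 * Real.pi * x) * (3 * Real.pi) / (3 * Real.pi)) +
          3 * Real.pi * (T - x) = σ * Real.cos (3 * Real.pi * x) + 3 * Real.pi * (T - x) := by
        field_simp
      rw [e] at h4
      exact h4)
    (by
      intro x y
      have h1 := hlip x y
      have e : (σ * Real.cos (3 * Real.pi * x) + 3 * Real.pi * (T - x)) -
        (σ * Real.cos (3 * Real.pi * y) + 3 * Real.pi * (T - y)) =
        (σ * Real.cos (3 * Real.pi * x) - σ * Real.cos (3 * Real.pi * y)) +
          3 * Real.pi * (y - x) := by ring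
      rw [e]
      refine (abs_add_le _ _).trans ?_
      have e2 : |3 * Real.pi * (y - x)| = 3 * Real.pi * |x - y| := by
        rw [abs_mul, abs_of_pos (by positivity), abs_sub_comm]
      rw [e2]; linarith)
    (by
      intro x _ hxT
      have h1 := hT0 x
      rw [abs_of_nonpos (by linarith : x - T ≤ 0)] at h1
      have := (abs_le.1 h1).1
      linarith)
  have hSsum := UB.sum (Finset.Icc 1 m) (fun k _ => hS k)
  have h3 := (hUB.add (hχ.smul (a := m * (1 + 3 * Real.pi * T)) (by positivity))).add
    ((hSsum.smul (a := 3 * Real.pi) (by positivity)).add (UB.const (-(3 * Real.pi * (m * T)))))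
  refine (h3.mono ?_).le ?_
  · filter_upwards [eventually_ge_atTop 1] with n hn
    have hpos : ∀ k, lam (n + 1) ≤ lam (n + (k + 1)) := by
      intro k
      induction k with
      | zero => simp
      | succ k ih => exact ih.trans (hmono (n + (k + 1)) (by omega)).le
    have hpt : ∀ k ∈ Finset.Icc 1 m, σ * Real.cos (3 * Real.pi * (lam (n + k) - lam n)) ≤
        ind (1 / 2) T (lam (n + k) - lam n) *
          (σ * Real.cos (3 * Real.pi * (lam (n + k) - lam n)) +
            3 * Real.pi * (T - (lam (n + k) - lam n))) +
        (1 + 3 * Real.pi * T) * χ n + 3 * Real.pi * (lam (n + k) - lam n) - 3 * Real.pi * T := by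
      intro k hk
      rw [Finset.mem_Icc] at hk
      have h1 : lam (n + 1) ≤ lam (n + k) := by
        have := hpos (k - 1)
        rwa [Nat.sub_add_cancel hk.1] at this
      have h2 := hmono n hn
      set s := lam (n + k) - lam n with hs
      have hc : 0 ≤ (1 + 3 * Real.pi * T) * χ n := mul_nonneg (by positivity) (hχ0 n)
      rcases lt_or_ge s (1 / 2) with h | h
      · have e : ind (1 / 2) T s = 0 := by
          unfold ind; rw [if_neg]; intro h'; linarith [h'.1]
        rw [e, hχ1 n (by linarith)]
        have := hle1 s
        have : 0 ≤ 3 * Real.pi * s := mul_nonneg (by positivity) (by linarith)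
        linarith
      · rcases lt_or_ge s T with h' | h'
        · have e : ind (1 / 2) T s = 1 := by
            unfold ind; rw [if_pos ⟨h, h'⟩]
          rw [e]; linarith
        · have e : ind (1 / 2) T s = 0 := by
            unfold ind; rw [if_neg]; intro h''; linarith [h''.2]
          rw [e]
          have h1 := hT0 s
          rw [abs_of_nonneg (by linarith : 0 ≤ s - T)] at h1
          have := (abs_le.1 h1).2
          linarith
    refine (Finset.sum_le_sum hpt).trans (le_of_eq ?_)
    rw [Finset.sum_sub_distrib, Finset.sum_add_distrib, Finset.sum_add_distrib, ← Finset.mul_sum (Finset.Icc 1 m) (fun k => lam (n + k) - lam n)]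
    simp only [Finset.sum_const, Nat.card_Icc, nsmul_eq_mul, Nat.add_sub_cancel]
    ring
  · have e1 : ∑ k ∈ Finset.Icc 1 m, (k : ℝ) = m * (m + 1) / 2 := by
      clear_value σ T
      clear * -
      induction m with
      | zero => simp
      | succ k ih => rw [Finset.sum_Icc_succ_top (by omega), ih]; push_cast; ring
    have e2 : Real.sin (3 * Real.pi * T) = -σ := by rw [hT, hσ]; exact sin_T m
    have e3 : Real.sin (3 * Real.pi * (1 / 2)) = -1 := by
      have := sin_T 0
      simpa using this
    rw [e1, e2, e3]
    apply le_of_eq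
    have hA : σ * (-σ / (3 * Real.pi)) = - (1 / (3 * Real.pi)) := by
      rw [mul_div_assoc', mul_neg, hσsq]; ring
    rw [hA, hT]
    ring

lemma psd (t : ℕ → ℝ) : -7 ≤ ∑ k ∈ Finset.Icc 1 6, ∑ j ∈ Finset.range (7 - k),
    2 * ((-1) ^ k * Real.cos (t (j + k) - t j)) := by
  have h1 := sq_nonneg (Real.cos (t 0) - Real.cos (t 1) + Real.cos (t 2) - Real.cos (t 3)
    + Real.cos (t 4) - Real.cos (t 5) + Real.cos (t 6))
  have h2 := sq_nonneg (Real.sin (t 0) - Real.sin (t 1) + Real.sin (t 2) - Real.sin (t 3)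
    + Real.sin (t 4) - Real.sin (t 5) + Real.sin (t 6))
  have hs := fun i => Real.sin_sq_add_cos_sq (t i)
  have e : Finset.Icc 1 6 = ({1, 2, 3, 4, 5, 6} : Finset ℕ) := by decide
  rw [e]
  simp [Finset.sum_range_succ, Real.cos_sub]
  linarith [hs 0, hs 1, hs 2, hs 3, hs 4, hs 5, hs 6]

lemma hS_of {lam : ℕ → ℝ} (h : UB (fun n => lam (n + 1) - lam n) 1) (k : ℕ) :
    UB (fun n => lam (n + k) - lam n) k := by
  induction k with
  | zero => simpa using UB.zero
  | succ k ih =>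
    have := (h.shift k).add ih
    refine (this.mono' (fun n => ?_)).le ?_
    · have e : n + k + 1 = n + (k + 1) := by ring
      rw [e]; linarith
    · push_cast; linarith

end PPCaux

open PPCaux in
open scoped Classical in
/-- Let `λ_1 < λ_2 < …` be a strictly increasing sequence of real numbers with average gap `1`
and Poisson pair correlations (for every bounded interval `I ⊆ ℝ`, the pair-correlation count
`(1/N)·#{(i,j) : 1 ≤ i,j ≤ N, i ≠ j, λ_j − λ_i ∈ I}` tends to `|I|`). Then
`limsup_{n→∞} (λ_{n+1} − λ_n) > 3/2 + 10⁻⁹`. -/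
theorem stmt_0 (lam : ℕ → ℝ)
    (hmono : ∀ n, 1 ≤ n → lam n < lam (n + 1))
    (havg : Tendsto (fun N : ℕ => (∑ n ∈ Finset.Icc 1 N, (lam (n + 1) - lam n)) / N)
      atTop (nhds 1))
    (hppc : ∀ I : Set ℝ, I.OrdConnected → Bornology.IsBounded I →
      Tendsto (fun N : ℕ =>
          (((Finset.Icc 1 N ×ˢ Finset.Icc 1 N).filter
            (fun p => p.1 ≠ p.2 ∧ lam p.2 - lam p.1 ∈ I)).card : ℝ) / N)
        atTop (nhds (MeasureTheory.volume I).toReal)) :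
    Filter.limsup (fun n : ℕ => ((lam (n + 1) - lam n : ℝ) : EReal)) atTop
      > ((3 / 2 + 1 / 10 ^ 9 : ℝ) : EReal) := by
  by_contra hcon
  rw [gt_iff_lt, not_lt] at hcon
  have hev : ∀ᶠ n : ℕ in atTop, lam (n + 1) - lam n < 3 / 2 + 2 / 10 ^ 9 := by
    have h1 : Filter.limsup (fun n : ℕ => ((lam (n + 1) - lam n : ℝ) : EReal)) atTop
        < ((3 / 2 + 2 / 10 ^ 9 : ℝ) : EReal) :=
      lt_of_le_of_lt hcon (EReal.coe_lt_coe_iff.2 (by norm_num))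
    filter_upwards [eventually_lt_of_limsup_lt h1] with n hn
    exact EReal.coe_lt_coe_iff.1 hn
  have hg : UB (fun n => lam (n + 1) - lam n) 1 := bound_of_tendsto havg
  have hgneg : UB (fun n => -(lam (n + 1) - lam n)) (-1) := by
    apply bound_of_tendsto
    refine havg.neg.congr (fun N => ?_)
    rw [Finset.sum_neg_distrib, neg_div]
  have hi := fun m => ppc_ind lam hppc m
  -- Step D
  have hD0 := ppc_fun (hi 1) (F := fun x => x - 1 / 2) (Φ := fun x => (x - 1 / 2) ^ 2 / 2)
    (L := 1) (a := 1 / 2) (b := 3 / 2 + 2 / 10 ^ 9) (by norm_num)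
    (by
      intro x
      have := (((hasDerivAt_id x).sub_const (1 / 2)).pow 2).div_const 2
      simpa using this)
    (by intro x y; rw [one_mul, sub_sub_sub_cancel_right])
    (by intro x h _; linarith)
  have hD := (hD0.add hgneg).add (UB.const (1 / 2))
  have hI := hi 1 (1 / 2 - 1 / 10 ^ 4) (1 / 2) (by norm_num)
  have hE := hI.add (hD.smul (a := 10 ^ 4) (by norm_num))
  simp only [Finset.Icc_self, Finset.sum_singleton] at hE
  have hχ : UB (fun n => if lam (n + 1) - lam n < 1 / 2 then (1 : ℝ) else 0) (15 / 10 ^ 5) := by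
    refine (hE.mono ?_).le (by norm_num)
    filter_upwards [hev] with n hn
    set s := lam (n + 1) - lam n with hs
    unfold ind
    rcases lt_or_ge s (1 / 2) with h | h
    · rw [if_pos h]
      rw [if_neg (fun h' : 1 / 2 ≤ s ∧ s < 3 / 2 + 2 / 10 ^ 9 => by linarith [h'.1])]
      by_cases h2 : 1 / 2 - 1 / 10 ^ 4 ≤ s
      · rw [if_pos ⟨h2, h⟩]; linarith
      · rw [if_neg (fun h' => h2 h'.1)]
        push Not at h2
        linarith
    · rw [if_neg (by linarith), if_neg (fun h' : 1 / 2 - 1 / 10 ^ 4 ≤ s ∧ s < 1 / 2 => by linarith [h'.2]),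
        if_pos ⟨h, hn⟩]
      linarith
  -- Step F
  have hF := fun (m : ℕ) (hm : 1 ≤ m) => stepF hm hmono (hi m) (hS_of hg) hχ
    (by intro n; split_ifs <;> norm_num) (by intro n h; rw [if_pos h])
  have hG := UB.sum (Finset.Icc 1 6) (fun m hm =>
    (hF m (Finset.mem_Icc.1 hm).1).smul (a := 2 * (2 * (7 - (m : ℝ)) - 1)) (by
      have : (m : ℝ) ≤ 6 := by exact_mod_cast (Finset.mem_Icc.1 hm).2
      linarith))
  have hdiff := UB.sum (Finset.Icc 1 6) (fun k _ => UB.sum (Finset.range (7 - k)) (fun j _ =>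
    (UB.diff (φ := fun n => (-1) ^ k * Real.cos (3 * Real.pi * (lam (n + k) - lam n))) (B := 1)
      (by intro n; rw [abs_mul]; simpa using Real.abs_cos_le_one _) j).smul
        (a := 2) (by norm_num)))
  have hfin := hG.add hdiff
  have hge := hfin.ge (d := -7) (by
    intro n
    have := psd (fun j => 3 * Real.pi * lam (n + j))
    refine this.trans (le_of_eq ?_)
    have e : Finset.Icc 1 6 = ({1, 2, 3, 4, 5, 6} : Finset ℕ) := by decide
    simp only [e]
    simp [Finset.sum_range_succ, e, ← mul_sub]
    have e5 : Finset.Icc 1 5 = ({1, 2, 3, 4, 5} : Finset ℕ) := by decide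
    have e4 : Finset.Icc 1 4 = ({1, 2, 3, 4} : Finset ℕ) := by decide
    have e3 : Finset.Icc 1 3 = ({1, 2, 3} : Finset ℕ) := by decide
    have e2 : Finset.Icc 1 2 = ({1, 2} : Finset ℕ) := by decide
    simp [e5, e4, e3, e2, add_assoc]
    ring)
  have e : Finset.Icc 1 6 = ({1, 2, 3, 4, 5, 6} : Finset ℕ) := by decide
  simp [e] at hge
  have hp1 := Real.pi_lt_d4
  have hp0 := Real.pi_gt_d4
  have hinv : 1 / (3 * 3.1416) ≤ 1 / (3 * Real.pi) := by
    apply one_div_le_one_div_of_le <;> linarith [Real.pi_pos]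
  rw [div_eq_mul_one_div (-1 - 1) (3 * Real.pi), div_eq_mul_one_div ((-1) ^ 3 - 1) (3 * Real.pi),
    div_eq_mul_one_div ((-1) ^ 4 - 1) (3 * Real.pi), div_eq_mul_one_div ((-1) ^ 5 - 1) (3 * Real.pi),
    div_eq_mul_one_div ((-1) ^ 6 - 1) (3 * Real.pi)] at hge
  generalize 1 / (3 * Real.pi) = y at hge hinv
  norm_num at hge hinv hp1 hp0
  linarith
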